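/- Let X be a set and Γ a set of fuzzy subsets of X whose pointwise supremum is the constant function 1 and which is closed under ⊕, ⊙, and pointwise min ∧. Then Ω = {pointwise suprema of subfamilies of Γ} is an MV-topology on X, and Γ is a base for Ω. -/

import Mathlib

open Set unitInterval

noncomputable section

instance : Fact ((0:ℝ) ≤ 1) := ⟨zero_le_one⟩

noncomputable instance : CompleteLattice unitInterval := Set.Icc.completeLattice

namespace MVStone

/-- Truncated sum on [0,1]. -/
def oplus (a b : unitInterval) : unitInterval :=
  ⟨min (a.1 + b.1) 1, ⟨le_min (add_nonneg a.2.1 b.2.1) zero_le_one, min_le_right _ _⟩⟩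

/-- Truncated product (Łukasiewicz t-norm) on [0,1]. -/
def odot (a b : unitInterval) : unitInterval :=
  ⟨max (a.1 + b.1 - 1) 0, ⟨le_max_right _ _, max_le (by have := a.2.2; have := b.2.2; linarith) zero_le_one⟩⟩

/-- Truncated difference on [0,1]. -/
def ominus (a b : unitInterval) : unitInterval :=
  ⟨max (a.1 - b.1) 0, ⟨le_max_right _ _, max_le (by have := a.2.2; have := b.2.1; linarith) zero_le_one⟩⟩

variable {X : Type*}

def pOplus (α β : X → unitInterval) : X → unitInterval := fun x => oplus (α x) (β x)
def pOdot (α β : X → unitInterval) : X → unitInterval := fun x => odot (α x) (β x)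
def pStar (α : X → unitInterval) : X → unitInterval := fun x => σ (α x)
def pMin (α β : X → unitInterval) : X → unitInterval := fun x => min (α x) (β x)
def pMax (α β : X → unitInterval) : X → unitInterval := fun x => max (α x) (β x)

/-- Pointwise supremum of a family of fuzzy subsets. -/
def pSup (Γ : Set (X → unitInterval)) : X → unitInterval := fun x => ⨆ α ∈ Γ, α x
/-- Pointwise infimum of a family of fuzzy subsets. -/
def pInf (Γ : Set (X → unitInterval)) : X → unitInterval := fun x => ⨅ α ∈ Γ, α x

structure IsMVTopology (Ω : Set (X → unitInterval)) : Prop where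
  zero_mem : (fun _ => (0 : unitInterval)) ∈ Ω
  one_mem : (fun _ => (1 : unitInterval)) ∈ Ω
  sSup_mem : ∀ Γ ⊆ Ω, pSup Γ ∈ Ω
  oplus_mem : ∀ α ∈ Ω, ∀ β ∈ Ω, pOplus α β ∈ Ω
  odot_mem : ∀ α ∈ Ω, ∀ β ∈ Ω, pOdot α β ∈ Ω
  min_mem : ∀ α ∈ Ω, ∀ β ∈ Ω, pMin α β ∈ Ω

def IsCovering (Γ : Set (X → unitInterval)) : Prop := pSup Γ = fun _ => 1

/-- `⊕`-sum of a finite list of fuzzy subsets. -/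
def sumList (l : List (X → unitInterval)) : X → unitInterval :=
  l.foldr pOplus (fun _ => 0)

/-- Compactness: every open covering contains a finite list whose `⊕`-sum is `1`. -/
def MVCompact (Ω : Set (X → unitInterval)) : Prop :=
  ∀ Γ ⊆ Ω, IsCovering Γ →
    ∃ l : List (X → unitInterval), (∀ o ∈ l, o ∈ Γ) ∧ sumList l = fun _ => 1

/-- Strong compactness: every open covering contains a finite subcovering. -/
def MVStronglyCompact (Ω : Set (X → unitInterval)) : Prop :=
  ∀ Γ ⊆ Ω, IsCovering Γ → ∃ F ⊆ Γ, F.Finite ∧ IsCovering F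

def MVHausdorff (Ω : Set (X → unitInterval)) : Prop :=
  ∀ x y : X, x ≠ y → ∃ ox ∈ Ω, ∃ oy ∈ Ω,
    ox x = 1 ∧ oy y = 1 ∧ pMin ox oy = fun _ => 0

def IsBase (Ω Θ : Set (X → unitInterval)) : Prop :=
  Θ ⊆ Ω ∧ ∀ o ∈ Ω, ∃ G ⊆ Θ, o = pSup G

def MVClopen (Ω : Set (X → unitInterval)) (α : X → unitInterval) : Prop :=
  α ∈ Ω ∧ pStar α ∈ Ω

def Clop (Ω : Set (X → unitInterval)) : Set (X → unitInterval) := {α | MVClopen Ω α}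

def IsStoneMVSpace (Ω : Set (X → unitInterval)) : Prop :=
  IsMVTopology Ω ∧ MVCompact Ω ∧ MVHausdorff Ω ∧
    ∃ Θ, IsBase Ω Θ ∧ ∀ θ ∈ Θ, MVClopen Ω θ

/-- Ideal of a set `A` of fuzzy subsets closed under `⊕` (w.r.t. the pointwise order). -/
def IsIdealOf (A M : Set (X → unitInterval)) : Prop :=
  M ⊆ A ∧ (fun _ => (0 : unitInterval)) ∈ M ∧ (∀ a ∈ M, ∀ b ∈ M, pOplus a b ∈ M) ∧
    ∀ a ∈ A, ∀ b ∈ M, a ≤ b → a ∈ M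

def IsMaximalIdealOf (A M : Set (X → unitInterval)) : Prop :=
  IsIdealOf A M ∧ M ≠ A ∧ ∀ N, IsIdealOf A N → N ≠ A → M ⊆ N → M = N


theorem isLUB_pSup (G : Set (X → unitInterval)) (x : X) :
    IsLUB ((fun α => α x) '' G) (pSup G x) := by
  constructor
  · rintro _ ⟨α, hα, rfl⟩
    exact le_iSup₂ (f := fun (α : X → unitInterval) (_ : α ∈ G) => α x) α hα
  · intro c hc
    exact iSup₂_le fun α hα => hc ⟨α, hα, rfl⟩

theorem le_pSup {G : Set (X → unitInterval)} {α : X → unitInterval} (hα : α ∈ G) (x : X) :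
    α x ≤ pSup G x :=
  (isLUB_pSup G x).1 ⟨α, hα, rfl⟩

theorem pSup_le {G : Set (X → unitInterval)} {x : X} {c : unitInterval}
    (h : ∀ α ∈ G, α x ≤ c) : pSup G x ≤ c :=
  (isLUB_pSup G x).2 (by rintro _ ⟨α, hα, rfl⟩; exact h α hα)

theorem pSup_empty : pSup (∅ : Set (X → unitInterval)) = fun _ => 0 :=
  funext fun x => le_antisymm (pSup_le fun _ h => h.elim) (pSup (X := X) ∅ x).2.1

theorem pSup_singleton (α : X → unitInterval) : pSup {α} = α :=
  funext fun x => le_antisymm (pSup_le fun β h => by rw [mem_singleton_iff.1 h])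
    (le_pSup (mem_singleton α) x)

/-- A continuous operation, monotone in both arguments, commutes with suprema of nonempty
families. -/
theorem map₂_pSup {f : unitInterval → unitInterval → unitInterval}
    (hf : Continuous (Function.uncurry f))
    (hmono : ∀ a a' b b', a ≤ a' → b ≤ b' → f a b ≤ f a' b')
    {G H : Set (X → unitInterval)} (hG : G.Nonempty) (hH : H.Nonempty) :
    (fun x => f (pSup G x) (pSup H x)) = pSup (image2 (fun α β x => f (α x) (β x)) G H) := by
  funext x
  apply le_antisymm
  · have hmem := map_mem_closure₂ (u := Iic (pSup (image2 (fun α β x => f (α x) (β x)) G H) x)) hf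
      ((isLUB_pSup G x).mem_closure (hG.image _))
      ((isLUB_pSup H x).mem_closure (hH.image _)) (by
        rintro _ ⟨α, hα, rfl⟩ _ ⟨β, hβ, rfl⟩
        exact le_pSup (mem_image2_of_mem (f := fun α β x => f (α x) (β x)) hα hβ) x)
    rwa [isClosed_Iic.closure_eq] at hmem
  · apply pSup_le
    rintro _ ⟨α, hα, β, hβ, rfl⟩
    exact hmono _ _ _ _ (le_pSup hα x) (le_pSup hβ x)

theorem continuous_oplus : Continuous (Function.uncurry oplus) := by
  unfold Function.uncurry oplus
  fun_prop

theorem continuous_odot : Continuous (Function.uncurry odot) := by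
  unfold Function.uncurry odot
  fun_prop

theorem oplus_mono (a a' b b' : unitInterval) (ha : a ≤ a') (hb : b ≤ b') :
    oplus a b ≤ oplus a' b' :=
  Subtype.mk_le_mk.2 (min_le_min_right _ (add_le_add (α := ℝ) ha hb))

theorem odot_mono (a a' b b' : unitInterval) (ha : a ≤ a') (hb : b ≤ b') :
    odot a b ≤ odot a' b' :=
  Subtype.mk_le_mk.2 (max_le_max_right _ (sub_le_sub_right (add_le_add (α := ℝ) ha hb) 1))

theorem oplus_zero (a : unitInterval) : oplus a 0 = a :=
  Subtype.ext (by simp [oplus, a.2.2])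

theorem zero_oplus (a : unitInterval) : oplus 0 a = a :=
  Subtype.ext (by simp [oplus, a.2.2])

theorem odot_zero (a : unitInterval) : odot a 0 = 0 :=
  Subtype.ext (by simp [odot, a.2.2])

theorem zero_odot (a : unitInterval) : odot 0 a = 0 :=
  Subtype.ext (by simp [odot, a.2.2])

/-- Suprema of subfamilies of `Γ` are closed under any continuous monotone operation preserving
`Γ`, provided this holds when one of the families is empty. -/
theorem exists_map₂_eq_pSup {f : unitInterval → unitInterval → unitInterval}
    (hf : Continuous (Function.uncurry f))
    (hmono : ∀ a a' b b', a ≤ a' → b ≤ b' → f a b ≤ f a' b')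
    (hr : (∀ a, f a 0 = a) ∨ ∀ a, f a 0 = 0) (hl : (∀ a, f 0 a = a) ∨ ∀ a, f 0 a = 0)
    {Γ : Set (X → unitInterval)} (hΓ : ∀ α ∈ Γ, ∀ β ∈ Γ, (fun x => f (α x) (β x)) ∈ Γ)
    {G H : Set (X → unitInterval)} (hG : G ⊆ Γ) (hH : H ⊆ Γ) :
    ∃ K ⊆ Γ, (fun x => f (pSup G x) (pSup H x)) = pSup K := by
  rcases G.eq_empty_or_nonempty with rfl | hGne
  · rcases hl with h | h
    · exact ⟨H, hH, by simp only [pSup_empty, h]⟩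
    · exact ⟨∅, empty_subset _, by simp only [pSup_empty, h]⟩
  rcases H.eq_empty_or_nonempty with rfl | hHne
  · rcases hr with h | h
    · exact ⟨G, hG, by simp only [pSup_empty, h]⟩
    · exact ⟨∅, empty_subset _, by simp only [pSup_empty, h]⟩
  exact ⟨_, image2_subset_iff.2 fun α hα β hβ => hΓ α (hG hα) β (hH hβ),
    map₂_pSup hf hmono hGne hHne⟩

theorem stmt11 {X : Type*} (Γ : Set (X → unitInterval))
    (hcov : pSup Γ = fun _ => (1 : unitInterval))
    (hplus : ∀ α ∈ Γ, ∀ β ∈ Γ, pOplus α β ∈ Γ)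
    (hdot : ∀ α ∈ Γ, ∀ β ∈ Γ, pOdot α β ∈ Γ)
    (hmin : ∀ α ∈ Γ, ∀ β ∈ Γ, pMin α β ∈ Γ) :
    IsMVTopology {o : X → unitInterval | ∃ G ⊆ Γ, o = pSup G} ∧
    IsBase {o : X → unitInterval | ∃ G ⊆ Γ, o = pSup G} Γ := by
  refine ⟨⟨⟨∅, empty_subset _, pSup_empty.symm⟩, ⟨Γ, Subset.rfl, hcov.symm⟩, ?_, ?_, ?_, ?_⟩,
    fun α hα => ⟨{α}, singleton_subset_iff.2 hα, (pSup_singleton α).symm⟩, fun _ ho => ho⟩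
  · intro F hF
    refine ⟨{γ ∈ Γ | ∀ x, γ x ≤ pSup F x}, sep_subset _ _, funext fun x => le_antisymm ?_ ?_⟩
    · refine pSup_le fun o ho => ?_
      obtain ⟨G, hG, rfl⟩ := hF ho
      exact pSup_le fun γ hγ =>
        le_pSup (show γ ∈ {γ ∈ Γ | ∀ x, γ x ≤ pSup F x} from
          ⟨hG hγ, fun y => (le_pSup hγ y).trans (le_pSup ho y)⟩) x
    · exact pSup_le fun γ hγ => hγ.2 x
  · rintro _ ⟨G, hG, rfl⟩ _ ⟨H, hH, rfl⟩
    exact exists_map₂_eq_pSup continuous_oplus oplus_mono (.inl oplus_zero) (.inl zero_oplus)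
      hplus hG hH
  · rintro _ ⟨G, hG, rfl⟩ _ ⟨H, hH, rfl⟩
    exact exists_map₂_eq_pSup continuous_odot odot_mono (.inr odot_zero) (.inr zero_odot)
      hdot hG hH
  · rintro _ ⟨G, hG, rfl⟩ _ ⟨H, hH, rfl⟩
    exact exists_map₂_eq_pSup (f := fun a b => min a b) (continuous_fst.min continuous_snd)
      (fun _ _ _ _ ha hb => min_le_min ha hb) (.inr fun a => min_eq_right a.2.1)
      (.inr fun a => min_eq_left a.2.1) hmin hG hH

end MVStone
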